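/- Let V₁ and V₂ be commuting isometries on a complex Hilbert space H, V := V₁V₂, C := I − V₁V₁* − V₂V₂* + VV*, and F₂ := P_{W₁}V₂P_{W₁} the Fringe operator. Then C is a compact operator if and only if both P_{W₁} − F₂F₂* and P_{W₁} − F₂*F₂ are compact operators. -/

import Mathlib

open ContinuousLinearMap
open scoped InnerProductSpace

/-- If `A* A` is compact then so is `A`. -/
theorem compact_of_adjoint_comp_self {H : Type*} [NormedAddCommGroup H] [InnerProductSpace ℂ H]
    [CompleteSpace H] (A : H →L[ℂ] H) (h : IsCompactOperator ⇑(adjoint A * A)) :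
    IsCompactOperator ⇑A := by
  have h1 := (isCompactOperator_iff_isCompact_closure_image_ball
    ((adjoint A * A : H →L[ℂ] H) : H →ₗ[ℂ] H) (r := 1) one_pos).1 h
  refine (isCompactOperator_iff_isCompact_closure_image_ball
    (A : H →ₗ[ℂ] H) (r := 1) one_pos).2 ?_
  have h2 := h1.totallyBounded.subset subset_closure
  refine TotallyBounded.isCompact_of_isClosed (TotallyBounded.closure ?_) isClosed_closure
  rw [Metric.totallyBounded_iff]
  intro ε hε
  obtain ⟨t, hts, htf, hcov⟩ := Metric.finite_approx_of_totallyBounded h2 (ε ^ 2 / 2) (by positivity)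
  obtain ⟨u, hu, hut⟩ : ∃ u ⊆ Metric.ball (0 : H) 1, u.Finite ∧ (adjoint A * A) '' u = t := by
    obtain ⟨u, h1, h2, h3⟩ := (Set.exists_subset_image_finite_and (p := (· = t))).1
      ⟨t, hts, htf, (rfl : t = t)⟩
    exact ⟨u, h1, h2, h3⟩
  obtain ⟨huf, hut⟩ := hut
  refine ⟨A '' u, huf.image _, ?_⟩
  rintro _ ⟨x, hx, rfl⟩
  have := hcov ⟨x, hx, rfl⟩
  rw [← hut] at this
  simp only [Set.mem_iUnion, Set.mem_image, exists_prop] at this ⊢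
  obtain ⟨_, ⟨y, hy, rfl⟩, hxy⟩ := this
  refine ⟨_, ⟨y, hy, rfl⟩, ?_⟩
  have hy1 := hu hy
  rw [mem_ball_zero_iff] at hx hy1
  rw [Metric.mem_ball, dist_eq_norm] at hxy ⊢
  have e1 : ‖A (x - y)‖ ^ 2 ≤ ‖(adjoint A * A) (x - y)‖ * ‖x - y‖ := by
    rw [ContinuousLinearMap.apply_norm_sq_eq_inner_adjoint_left]
    exact (re_inner_le_norm _ _)
  have e2 : ‖x - y‖ ≤ 2 := (norm_sub_le _ _).trans (by linarith)
  have e3 : ‖(adjoint A * A) (x - y)‖ < ε ^ 2 / 2 := by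
    rw [map_sub]; exact hxy
  have e4 : ‖A (x - y)‖ < ε := by
    refine lt_of_pow_lt_pow_left₀ 2 hε.le ?_
    nlinarith [norm_nonneg ((adjoint A * A) (x - y)), norm_nonneg (x - y)]
  rw [map_sub] at e4
  exact e4

theorem fringe_algebra {R : Type*} [Ring R] (a b a' b' : R) (ha : a' * a = 1) (hb : b' * b = 1)
    (hc : a * b = b * a) (hc' : b' * a' = a' * b') (P C T T' : R) (hP : P = 1 - a * a')
    (hC : C = 1 - a * a' - b * b' + a * b * (b' * a'))
    (hT : T = a' * b * P) (hT' : T' = P * (b' * a)) :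
    P - (P * (b * P)) * (P * b' * P) = P * C * P ∧
    P - (P * b' * P) * (P * (b * P)) = T' * T ∧
    T = -(a' * C * b) ∧
    C = P * C * P - a * T * b' - P * b * T' * a' := by
  have r1 : ∀ x, a' * (a * x) = x := fun x => by rw [← mul_assoc, ha, one_mul]
  have r2 : ∀ x, b' * (b * x) = x := fun x => by rw [← mul_assoc, hb, one_mul]
  have r3 : ∀ x, b * (a * x) = a * (b * x) := fun x => by rw [← mul_assoc, ← hc, mul_assoc]
  have r4 : ∀ x, a' * (b' * x) = b' * (a' * x) := fun x => by rw [← mul_assoc, ← hc', mul_assoc]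
  have r5 : ∀ x, b' * (a * (b * x)) = a * x := fun x => by rw [← r3, r2]
  have r6 : ∀ x, b' * (a' * (b * x)) = a' * x := fun x => by rw [← r4, r2]
  have r5' : b' * (a * b) = a := by simpa using r5 1
  have r6' : b' * (a' * b) = a' := by simpa using r6 1
  subst hT hT' hC hP
  refine ⟨?_, ?_, ?_, ?_⟩ <;>
  · simp only [mul_sub, sub_mul, mul_add, add_mul, mul_one, one_mul, mul_assoc, ha, hb, ← hc,
      ← hc', r1, r2, r3, r4, r5, r6, r5', r6', neg_sub, neg_add]
    try abel

/-- For commuting isometries `V₁, V₂` on a complex Hilbert space, with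
`V := V₁V₂`, `C := I − V₁V₁* − V₂V₂* + VV*` and Fringe operator `F₂ := P_{W₁}V₂P_{W₁}`:
`C` is compact if and only if both `P_{W₁} − F₂F₂*` and `P_{W₁} − F₂*F₂` are compact. -/
theorem stmt7 {H : Type*} [NormedAddCommGroup H] [InnerProductSpace ℂ H] [CompleteSpace H]
    (V₁ V₂ : H →L[ℂ] H)
    (hV₁ : adjoint V₁ ∘L V₁ = 1) (hV₂ : adjoint V₂ ∘L V₂ = 1)
    (hcomm : V₁ ∘L V₂ = V₂ ∘L V₁)
    (C F₂ : H →L[ℂ] H)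
    (hC : C = 1 - V₁ ∘L adjoint V₁ - V₂ ∘L adjoint V₂
        + (V₁ ∘L V₂) ∘L adjoint (V₁ ∘L V₂))
    (hF₂ : F₂ = (1 - V₁ ∘L adjoint V₁) ∘L (V₂ ∘L (1 - V₁ ∘L adjoint V₁))) :
    IsCompactOperator ⇑C ↔
      (IsCompactOperator ⇑((1 - V₁ ∘L adjoint V₁) - F₂ ∘L adjoint F₂) ∧
       IsCompactOperator ⇑((1 - V₁ ∘L adjoint V₁) - adjoint F₂ ∘L F₂)) := by
  have hadjP : adjoint (1 - V₁ * adjoint V₁) = 1 - V₁ * adjoint V₁ := by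
    simp only [← star_eq_adjoint]; simp
  have hadjF : adjoint F₂ = (1 - V₁ * adjoint V₁) * adjoint V₂ * (1 - V₁ * adjoint V₁) := by
    rw [hF₂]
    simp only [← star_eq_adjoint, ← mul_def]; simp [mul_assoc]
  have hc' : adjoint V₂ * adjoint V₁ = adjoint V₁ * adjoint V₂ := by
    have := congrArg adjoint hcomm
    simpa only [adjoint_comp, mul_def] using this
  have hT' : adjoint (adjoint V₁ * V₂ * (1 - V₁ * adjoint V₁))
      = (1 - V₁ * adjoint V₁) * (adjoint V₂ * V₁) := by
    simp only [← star_eq_adjoint]; simp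
  obtain ⟨e1, e2, e3, e4⟩ := fringe_algebra V₁ V₂ (adjoint V₁) (adjoint V₂) hV₁ hV₂ hcomm hc'
    _ C _ _ rfl (by rw [hC, adjoint_comp]; rfl) rfl rfl
  rw [hadjF, hF₂]
  simp only [← mul_def] at *
  rw [e1, e2]
  rw [← hT'] at e4 ⊢
  generalize adjoint V₁ * V₂ * (1 - V₁ * adjoint V₁) = T at *
  generalize (1 - V₁ * adjoint V₁) = P at *
  have mulL : ∀ A B : H →L[ℂ] H, IsCompactOperator ⇑B → IsCompactOperator ⇑(A * B) :=
    fun A B h => h.clm_comp A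
  have mulR : ∀ A B : H →L[ℂ] H, IsCompactOperator ⇑A → IsCompactOperator ⇑(A * B) :=
    fun A B h => h.comp_clm B
  constructor
  · intro h
    refine ⟨mulR _ _ (mulL _ _ h), mulL _ _ ?_⟩
    rw [e3]
    exact (mulR _ _ (mulL _ _ h)).neg
  · rintro ⟨h1, h2⟩
    have hTc := compact_of_adjoint_comp_self T h2
    have hTc' : IsCompactOperator ⇑(adjoint T) := by
      apply compact_of_adjoint_comp_self
      rw [adjoint_adjoint]
      exact mulR _ _ hTc
    rw [e4]
    exact (h1.sub (mulR _ _ (mulL _ _ hTc))).sub (mulR _ _ (mulL _ _ hTc'))
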